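/- arXiv:1408.3160 — 9 statements merged into one kernel-verified Lean document; each statement's English description precedes it below -/
import Mathlib

section
/- Let h : ℝ → ℝ be nonnegative, locally integrable, periodic with period 1, satisfying h(1 − {x}) = h({x}) for every real x and ∫₀¹ h(t)dt = 1. Let α > 0 be irrational and let x : ℕ → ℝ be a nonnegative sequence with ∫₀^{x_n} h(t)dt = n·α for every n. If (q_j) is a strictly increasing sequence of positive integers such that for every j and every integer k with 1 ≤ k ≤ q_j − 1 one has ‖x_{q_j}‖ < ‖x_k‖, then for every j there exists an integer p_j such that p_j/q_j is a best approximation of α. -/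
open MeasureTheory

/-- The distance from a real number to the nearest integer. -/
noncomputable def distNearestInt (x : ℝ) : ℝ := |x - round x|

/-- `p/q` (with `q > 0`) is a best approximation of `α`:
`‖qα‖ = |qα − p|` and `|qα − p| < ‖jα‖` for every integer `1 ≤ j < q`. -/
def IsBestApprox (α : ℝ) (p q : ℤ) : Prop :=
  0 < q ∧ distNearestInt (q * α) = |q * α - p| ∧
    ∀ j : ℤ, 1 ≤ j → j < q → |q * α - p| < distNearestInt (j * α)

theorem distNearestInt_eq_abs_sub_of_le_half {y : ℝ} {n : ℤ} (hn : |y - n| ≤ 1 / 2) :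
    distNearestInt y = |y - n| := by
  refine le_antisymm (round_le y n) ?_
  by_contra! hlt
  have hne : n = round y := by
    have h1 : |((n - round y : ℤ) : ℝ)| < 1 := by
      unfold distNearestInt at hlt
      have := abs_sub_le (n : ℝ) y (round y)
      rw [abs_sub_comm (n : ℝ) y] at this
      push_cast
      linarith
    have h2 : |n - round y| < 1 := by exact_mod_cast h1
    have := Int.abs_lt_one_iff.mp h2
    omega
  rw [hne] at hlt
  exact lt_irrefl _ hlt

theorem distNearestInt_intervalIntegral {h : ℝ → ℝ} (hpos : ∀ t, 0 ≤ h t)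
    (hI : ∀ a b, IntervalIntegrable h volume a b) (hper : Function.Periodic h 1)
    (heven : Function.Even h) (hint : (∫ t in (0:ℝ)..1, h t) = 1) (y : ℝ) :
    distNearestInt (∫ t in (0:ℝ)..y, h t) = ∫ t in (0:ℝ)..distNearestInt y, h t := by
  have hodd : ∀ e : ℝ, (∫ t in (0:ℝ)..(-e), h t) = -∫ t in (0:ℝ)..e, h t := by
    intro e
    have := intervalIntegral.integral_comp_neg (a := 0) (b := e) h
    simp only [heven _, neg_zero] at this
    rw [this, intervalIntegral.integral_symm]
  have hshift : ∀ (e : ℝ) (n : ℤ), (∫ t in (0:ℝ)..(e + n), h t) = (∫ t in (0:ℝ)..e, h t) + n := by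
    intro e n
    rw [← intervalIntegral.integral_add_adjacent_intervals (hI 0 e) (hI e _)]
    have := hper.intervalIntegral_add_zsmul_eq n e hI
    rw [hper.intervalIntegral_add_eq e 0, zero_add, hint] at this
    simp only [zsmul_eq_mul, mul_one] at this
    rw [this]
  have hhalf : (∫ t in (0:ℝ)..(1 / 2), h t) = 1 / 2 := by
    have h1 := hshift (-(1 / 2)) 1
    rw [hodd] at h1
    norm_num at h1 ⊢
    linarith
  have hmono : ∀ {a b : ℝ}, a ≤ b → (∫ t in (0:ℝ)..a, h t) ≤ ∫ t in (0:ℝ)..b, h t := by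
    intro a b hab
    rw [← intervalIntegral.integral_add_adjacent_intervals (hI 0 a) (hI a b)]
    linarith [intervalIntegral.integral_nonneg_of_forall (μ := volume) hab hpos]
  have habs : ∀ e : ℝ, |∫ t in (0:ℝ)..e, h t| = ∫ t in (0:ℝ)..|e|, h t := by
    intro e
    rcases le_total 0 e with he | he
    · rw [abs_of_nonneg he,
        abs_of_nonneg (intervalIntegral.integral_nonneg_of_forall he hpos)]
    · have h1 := intervalIntegral.integral_nonneg_of_forall (μ := volume) (neg_nonneg.mpr he) hpos
      rw [abs_of_nonpos he, hodd, abs_of_nonpos (by rw [hodd] at h1; linarith)]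
  have hsub : (∫ t in (0:ℝ)..y, h t) - round y = ∫ t in (0:ℝ)..(y - round y), h t := by
    have := hshift (y - round y) (round y)
    rw [sub_add_cancel] at this
    linarith
  have heq : |(∫ t in (0:ℝ)..y, h t) - round y| = ∫ t in (0:ℝ)..distNearestInt y, h t := by
    rw [hsub, habs, distNearestInt]
  rw [← heq]
  apply distNearestInt_eq_abs_sub_of_le_half
  rw [heq, ← hhalf]
  exact hmono (abs_sub_round y)

theorem Irrational.distNearestInt_mul_ne {α : ℝ} (hirr : Irrational α) {m n : ℤ}
    (hsub : m - n ≠ 0) (hadd : m + n ≠ 0) :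
    distNearestInt (m * α) ≠ distNearestInt (n * α) := by
  intro heq
  rcases abs_eq_abs.mp heq with h1 | h1
  · refine (hirr.intCast_mul hsub).ne_int (round (m * α) - round (n * α)) ?_
    push_cast
    linarith
  · refine (hirr.intCast_mul hadd).ne_int (round (m * α) + round (n * α)) ?_
    push_cast
    linarith

theorem stmt0 (h : ℝ → ℝ) (hpos : ∀ t, 0 ≤ h t)
    (hloc : LocallyIntegrable h volume)
    (hper : Function.Periodic h 1)
    (hsym : ∀ x : ℝ, h (1 - Int.fract x) = h (Int.fract x))
    (hint : (∫ t in (0:ℝ)..1, h t) = 1)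
    (α : ℝ) (hα : 0 < α) (hirr : Irrational α)
    (x : ℕ → ℝ) (hxnn : ∀ n, 0 ≤ x n)
    (hxint : ∀ n : ℕ, (∫ t in (0:ℝ)..(x n), h t) = n * α)
    (q : ℕ → ℕ) (hq : StrictMono q) (hqpos : ∀ j, 0 < q j)
    (hmin : ∀ j, ∀ k : ℕ, 1 ≤ k → k ≤ q j - 1 →
      distNearestInt (x (q j)) < distNearestInt (x k)) :
    ∀ j, ∃ p : ℤ, IsBestApprox α p (q j) := by
  intro j
  have hI : ∀ a b, IntervalIntegrable h volume a b := fun a b =>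
    (hloc.integrableOn_isCompact isCompact_uIcc).intervalIntegrable
  have heven : Function.Even h := by
    intro t
    have h1 : h (Int.fract t) = h t := by
      have := hper.sub_int_mul_eq (x := t) ⌊t⌋
      rwa [mul_one] at this
    have h2 : h (1 - Int.fract t) = h (-t) := by
      have := hper.int_mul (⌊t⌋ + 1) (-t)
      rw [← this]
      congr 1
      rw [Int.fract]
      push_cast
      ring
    rw [← h1, ← h2, hsym]
  have hdist : ∀ n : ℕ, distNearestInt (n * α) = ∫ t in (0:ℝ)..distNearestInt (x n), h t :=
    fun n => by rw [← hxint, distNearestInt_intervalIntegral hpos hI hper heven hint]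
  refine ⟨round ((q j : ℝ) * α), by exact_mod_cast hqpos j, by simp [distNearestInt], ?_⟩
  intro i hi1 hiq
  lift i to ℕ using by omega
  have hlt := hmin j i (by omega) (by omega)
  have hle : distNearestInt (q j * α) ≤ distNearestInt (i * α) := by
    rw [hdist, hdist, ← intervalIntegral.integral_add_adjacent_intervals
      (hI 0 (distNearestInt (x (q j)))) (hI _ (distNearestInt (x i)))]
    exact le_add_of_nonneg_right (intervalIntegral.integral_nonneg_of_forall hlt.le hpos)
  have hne := hirr.distNearestInt_mul_ne (m := q j) (n := i) (by omega) (by omega)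
  push_cast at hne ⊢
  exact lt_of_le_of_ne hle hne
end

section
/- Let h : ℝ → ℝ be nonnegative, locally integrable, periodic with period 1, and with ∫₀¹ h(t)dt = 1. Let α > 0 be irrational and let x : ℕ → ℝ be a nonnegative sequence with ∫₀^{x_n} h(t)dt = n·α for every n. Then for every n ≥ 1, ⌊nα⌋ = ⌊x_n⌋ and {nα} = ∫₀^{{x_n}} h(t)dt. -/
open MeasureTheory

/-- The integral of a function of period `1` and unit mass splits into the floor of the upper
endpoint and the integral up to its fractional part. -/
theorem Function.Periodic.integral_eq_floor_add_integral_fract {h : ℝ → ℝ}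
    (hper : Function.Periodic h 1) (hi : ∀ a b : ℝ, IntervalIntegrable h volume a b)
    (hint : (∫ t in (0:ℝ)..1, h t) = 1) (y : ℝ) :
    (∫ t in (0:ℝ)..y, h t) = ⌊y⌋ + ∫ t in (0:ℝ)..(Int.fract y), h t := by
  have hy : Int.fract y + ⌊y⌋ • (1 : ℝ) = y := by simp
  have hfloor := hper.intervalIntegral_add_zsmul_eq ⌊y⌋ (Int.fract y) hi
  rw [hy, hper.intervalIntegral_add_eq _ 0, zero_add, hint, zsmul_one] at hfloor
  rw [← intervalIntegral.integral_add_adjacent_intervals (hi 0 (Int.fract y)) (hi _ y), hfloor,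
    add_comm]

theorem stmt1 (h : ℝ → ℝ) (hpos : ∀ t, 0 ≤ h t)
    (hloc : LocallyIntegrable h volume)
    (hper : Function.Periodic h 1)
    (hint : (∫ t in (0:ℝ)..1, h t) = 1)
    (α : ℝ) (hα : 0 < α) (hirr : Irrational α)
    (x : ℕ → ℝ) (hxnn : ∀ n, 0 ≤ x n)
    (hxint : ∀ n : ℕ, (∫ t in (0:ℝ)..(x n), h t) = n * α) :
    ∀ n : ℕ, 1 ≤ n →
      ⌊(n : ℝ) * α⌋ = ⌊x n⌋ ∧
      Int.fract ((n : ℝ) * α) = ∫ t in (0:ℝ)..(Int.fract (x n)), h t := by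
  intro n hn
  have hi : ∀ a b : ℝ, IntervalIntegrable h volume a b := fun a b =>
    (hloc.integrableOn_isCompact isCompact_uIcc).intervalIntegrable
  have key := hper.integral_eq_floor_add_integral_fract hi hint (x n)
  rw [hxint] at key
  have hnonneg : 0 ≤ ∫ t in (0:ℝ)..(Int.fract (x n)), h t :=
    intervalIntegral.integral_nonneg (Int.fract_nonneg _) fun t _ => hpos t
  have hle : (∫ t in (0:ℝ)..(Int.fract (x n)), h t) ≤ 1 := by
    rw [← hint, ← intervalIntegral.integral_add_adjacent_intervals (hi 0 (Int.fract (x n))) (hi _ 1)]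
    exact le_add_of_nonneg_right <|
      intervalIntegral.integral_nonneg (Int.fract_lt_one _).le fun t _ => hpos t
  have hne : (∫ t in (0:ℝ)..(Int.fract (x n)), h t) ≠ 1 := by
    intro h_one
    rw [h_one] at key
    exact (hirr.natCast_mul (by omega : n ≠ 0)).ne_int (⌊x n⌋ + 1) (by push_cast; exact key)
  have hlt := lt_of_le_of_ne hle hne
  have hfloor : ⌊(n : ℝ) * α⌋ = ⌊x n⌋ :=
    Int.floor_eq_iff.mpr ⟨by linarith, by linarith⟩
  refine ⟨hfloor, ?_⟩
  rw [Int.fract, hfloor]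
  linarith
end

section
/- Let h : ℝ → ℝ be nonnegative, locally integrable, periodic with period 1, satisfying h(1 − {x}) = h({x}) for every real x and ∫₀¹ h(t)dt = 1. Let α > 0 be irrational and let x : ℕ → ℝ be a nonnegative sequence with ∫₀^{x_n} h(t)dt = n·α for every n. Then for every n ≥ 1, ‖nα‖ = ∫₀^{‖x_n‖} h(t)dt. -/
open MeasureTheory

theorem distNearestInt_int_add (k : ℤ) (u : ℝ) :
    distNearestInt (k + u) = distNearestInt u := by
  unfold distNearestInt
  rw [round_intCast_add]
  push_cast
  ring_nf

theorem distNearestInt_of_abs_le_half {u : ℝ} (hu : |u| ≤ 1 / 2) :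
    distNearestInt u = |u| := by
  unfold distNearestInt
  refine le_antisymm (by simpa using round_le u 0) ?_
  rcases eq_or_ne (round u) 0 with h0 | h0
  · simp [h0]
  · have h1 : (1 : ℝ) ≤ |(round u : ℝ)| := by exact_mod_cast Int.one_le_abs h0
    have h2 := abs_sub_abs_le_abs_sub (round u : ℝ) u
    rw [abs_sub_comm] at h2
    linarith

theorem Function.Periodic.even_of_fract_symm {h : ℝ → ℝ} (hper : Function.Periodic h 1)
    (hsym : ∀ x : ℝ, h (1 - Int.fract x) = h (Int.fract x)) : Function.Even h := fun t => by
  have h1 : h (Int.fract t) = h t := by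
    simpa using hper.sub_int_mul_eq (x := t) ⌊t⌋
  have h2 : h (1 - Int.fract t) = h (-t) := by
    have := hper.int_mul (⌊t⌋ + 1) (-t)
    rw [← this, Int.fract]
    push_cast
    ring_nf
  rw [← h2, hsym, h1]

theorem Function.Even.integral_zero_neg {h : ℝ → ℝ} (heven : Function.Even h) (y : ℝ) :
    (∫ t in (0:ℝ)..-y, h t) = -∫ t in (0:ℝ)..y, h t := by
  have := intervalIntegral.integral_comp_neg (a := 0) (b := y) h
  simp only [heven _, neg_zero] at this
  rw [this, intervalIntegral.integral_symm]

theorem Function.Even.integral_zero_abs {h : ℝ → ℝ} (heven : Function.Even h)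
    (hpos : ∀ t, 0 ≤ h t) (y : ℝ) :
    (∫ t in (0:ℝ)..|y|, h t) = |∫ t in (0:ℝ)..y, h t| := by
  have key : ∀ z : ℝ, 0 ≤ z → 0 ≤ ∫ t in (0:ℝ)..z, h t := fun z hz =>
    intervalIntegral.integral_nonneg hz fun t _ => hpos t
  rcases le_total 0 y with hy | hy
  · rw [abs_of_nonneg hy, abs_of_nonneg (key y hy)]
  · have := key (-y) (by linarith)
    rw [heven.integral_zero_neg] at this
    rw [abs_of_nonpos hy, heven.integral_zero_neg, abs_of_nonpos (by linarith)]

theorem Function.Periodic.integral_zero_int_add {h : ℝ → ℝ} (hper : Function.Periodic h 1)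
    (hI : ∀ a b, IntervalIntegrable h volume a b)
    (hint : (∫ t in (0:ℝ)..1, h t) = 1) (k : ℤ) (y : ℝ) :
    (∫ t in (0:ℝ)..k + y, h t) = k + ∫ t in (0:ℝ)..y, h t := by
  have := hper.intervalIntegral_add_zsmul_eq k y hI
  rw [hper.intervalIntegral_add_eq y 0, zero_add, hint] at this
  rw [← intervalIntegral.integral_add_adjacent_intervals (hI 0 y) (hI y _)]
  simp only [zsmul_eq_mul, mul_one] at this
  rw [add_comm (k : ℝ) y, this, add_comm]

theorem stmt2 (h : ℝ → ℝ) (hpos : ∀ t, 0 ≤ h t)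
    (hloc : LocallyIntegrable h volume)
    (hper : Function.Periodic h 1)
    (hsym : ∀ x : ℝ, h (1 - Int.fract x) = h (Int.fract x))
    (hint : (∫ t in (0:ℝ)..1, h t) = 1)
    (α : ℝ) (hα : 0 < α) (hirr : Irrational α)
    (x : ℕ → ℝ) (hxnn : ∀ n, 0 ≤ x n)
    (hxint : ∀ n : ℕ, (∫ t in (0:ℝ)..(x n), h t) = n * α) :
    ∀ n : ℕ, 1 ≤ n →
      distNearestInt ((n : ℝ) * α) = ∫ t in (0:ℝ)..(distNearestInt (x n)), h t := by
  intro n _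
  have heven := hper.even_of_fract_symm hsym
  have hI : ∀ a b, IntervalIntegrable h volume a b := fun a b =>
    (hloc.integrableOn_isCompact isCompact_uIcc).intervalIntegrable
  have hhalf : (∫ t in (0:ℝ)..1 / 2, h t) = 1 / 2 := by
    have h1 := hper.integral_zero_int_add hI hint 1 (-(1 / 2))
    rw [heven.integral_zero_neg] at h1
    norm_num at h1 ⊢
    linarith
  set d : ℝ := x n - round (x n) with hd
  have hsplit : (n : ℝ) * α = round (x n) + ∫ t in (0:ℝ)..d, h t := by
    rw [← hxint n, ← hper.integral_zero_int_add hI hint, hd, add_sub_cancel]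
  have hle : |∫ t in (0:ℝ)..d, h t| ≤ 1 / 2 := by
    rw [← heven.integral_zero_abs hpos, ← hhalf]
    exact intervalIntegral.integral_mono_interval le_rfl (abs_nonneg d)
      (abs_sub_round (x n)) (.of_forall hpos) (hI _ _)
  rw [hsplit, distNearestInt_int_add, distNearestInt_of_abs_le_half hle, distNearestInt, ← hd,
    heven.integral_zero_abs hpos]
end

section
/- Assume θ = Φ(φ₁, I)/(2·Φ(π, I)) is irrational, where φ₁ ∈ (0, π) satisfies cos φ₁ = 2r²/(1 − c)² − 1. Then for every integer k ≥ 2 such that γ_k < γ_m for every integer m with 1 ≤ m < k, there exists an integer p such that p/k is a best approximation of θ. -/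
open MeasureTheory

/-- `Φ(φ, I) = ∫₀^φ dt/√(I − cos t)`. -/
noncomputable def Phi (I φ : ℝ) : ℝ := ∫ t in (0:ℝ)..φ, 1 / Real.sqrt (I - Real.cos t)

theorem hasDerivAt_Phi {I : ℝ} (hI : 1 < I) (x : ℝ) :
    HasDerivAt (Phi I) (1 / √(I - Real.cos x)) x := by
  have hpos (t : ℝ) : √(I - Real.cos t) ≠ 0 :=
    (Real.sqrt_pos.2 (by linarith [Real.cos_le_one t])).ne'
  have hcont : Continuous fun t : ℝ => 1 / √(I - Real.cos t) :=
    continuous_const.div (by fun_prop) hpos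
  exact intervalIntegral.integral_hasDerivAt_right (hcont.intervalIntegrable _ _)
    (hcont.stronglyMeasurableAtFilter _ _) hcont.continuousAt

theorem Phi_zero (I : ℝ) : Phi I 0 = 0 := by simp [Phi]

theorem strictMono_Phi {I : ℝ} (hI : 1 < I) : StrictMono (Phi I) := by
  refine strictMono_of_deriv_pos fun x => ?_
  rw [(hasDerivAt_Phi hI x).deriv]
  have : 0 < I - Real.cos x := by linarith [Real.cos_le_one x]
  positivity

theorem continuous_Phi {I : ℝ} (hI : 1 < I) : Continuous (Phi I) :=
  continuous_iff_continuousAt.2 fun x => (hasDerivAt_Phi hI x).continuousAt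

theorem Phi_neg (I x : ℝ) : Phi I (-x) = -Phi I x := by
  have h := intervalIntegral.integral_comp_neg (a := 0) (b := x)
    (fun t => 1 / √(I - Real.cos t))
  simp only [Real.cos_neg, neg_zero] at h
  rw [Phi, Phi, h, intervalIntegral.integral_symm]

theorem Phi_add_two_pi {I : ℝ} (hI : 1 < I) (x : ℝ) :
    Phi I (x + 2 * Real.pi) = Phi I x + 2 * Phi I Real.pi := by
  have hd (y : ℝ) : HasDerivAt (fun y => Phi I (y + 2 * Real.pi) - Phi I y) 0 y := by
    have h1 := (hasDerivAt_Phi hI (y + 2 * Real.pi)).comp_add_const y (2 * Real.pi)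
    rw [Real.cos_add_two_pi] at h1
    exact (h1.sub (hasDerivAt_Phi hI y)).congr_deriv (sub_self _)
  have h := is_const_of_deriv_eq_zero (fun y => (hd y).differentiableAt)
    (fun y => (hd y).deriv) x (-Real.pi)
  simp only [Phi_neg, show -Real.pi + 2 * Real.pi = Real.pi by ring] at h
  linarith

theorem Phi_add_int_mul_two_pi {I : ℝ} (hI : 1 < I) (x : ℝ) (n : ℤ) :
    Phi I (x + n * (2 * Real.pi)) = Phi I x + n * (2 * Phi I Real.pi) := by
  induction n using Int.induction_on with
  | zero => simp
  | succ n ih =>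
    have h := Phi_add_two_pi hI (x + (n : ℤ) * (2 * Real.pi))
    rw [ih] at h
    push_cast at h ⊢
    rw [add_mul, one_mul, ← add_assoc, h]
    ring
  | pred n ih =>
    have h := Phi_add_two_pi hI (x + (-(n : ℤ) - 1 : ℤ) * (2 * Real.pi))
    rw [show x + (-(n : ℤ) - 1 : ℤ) * (2 * Real.pi) + 2 * Real.pi
      = x + (-(n : ℤ) : ℤ) * (2 * Real.pi) by push_cast; ring, ih] at h
    push_cast at h ⊢
    linarith

theorem Phi_pi_pos {I : ℝ} (hI : 1 < I) : 0 < Phi I Real.pi := by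
  simpa [Phi_zero] using strictMono_Phi hI Real.pi_pos

theorem surjective_Phi {I : ℝ} (hI : 1 < I) : Function.Surjective (Phi I) := by
  intro y
  have hK := Phi_pi_pos hI
  obtain ⟨n, hn⟩ := exists_nat_gt (|y| / (2 * Phi I Real.pi))
  rw [div_lt_iff₀ (by positivity)] at hn
  have h1 := Phi_add_int_mul_two_pi hI 0 n
  have h2 := Phi_add_int_mul_two_pi hI 0 (-n)
  rw [Phi_zero] at h1 h2
  push_cast at h1 h2
  exact mem_range_of_exists_le_of_exists_ge (continuous_Phi hI)
    ⟨_, h2.le.trans (by linarith [neg_abs_le y])⟩ ⟨_, le_trans (by linarith [le_abs_self y]) h1.ge⟩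

/-- The amplitude function, inverse to `Phi I` when `1 < I`. -/
noncomputable def amplitude (I : ℝ) : ℝ → ℝ := Function.invFun (Phi I)

theorem Phi_amplitude {I : ℝ} (hI : 1 < I) (x : ℝ) : Phi I (amplitude I x) = x :=
  Function.rightInverse_invFun (surjective_Phi hI) x

theorem amplitude_Phi {I : ℝ} (hI : 1 < I) (x : ℝ) : amplitude I (Phi I x) = x :=
  Function.leftInverse_invFun (strictMono_Phi hI).injective x

theorem strictMono_amplitude {I : ℝ} (hI : 1 < I) : StrictMono (amplitude I) := by
  intro x y hxy
  rwa [← (strictMono_Phi hI).lt_iff_lt, Phi_amplitude hI, Phi_amplitude hI]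

theorem surjective_amplitude {I : ℝ} (hI : 1 < I) : Function.Surjective (amplitude I) :=
  fun x => ⟨_, amplitude_Phi hI x⟩

theorem hasDerivAt_amplitude {I : ℝ} (hI : 1 < I) (x : ℝ) :
    HasDerivAt (amplitude I) (√(I - Real.cos (amplitude I x))) x := by
  have hpos : 0 < I - Real.cos (amplitude I x) := by
    linarith [Real.cos_le_one (amplitude I x)]
  have h := HasDerivAt.of_local_left_inverse
    ((strictMono_amplitude hI).monotone.continuous_of_surjective
      (surjective_amplitude hI)).continuousAt
    (hasDerivAt_Phi hI (amplitude I x)) (by positivity)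
    (Filter.Eventually.of_forall (Phi_amplitude hI))
  simpa using h

theorem amplitude_zero {I : ℝ} (hI : 1 < I) : amplitude I 0 = 0 := by
  simpa [Phi_zero] using amplitude_Phi hI 0

theorem amplitude_neg {I : ℝ} (hI : 1 < I) (x : ℝ) : amplitude I (-x) = -amplitude I x := by
  apply (strictMono_Phi hI).injective
  rw [Phi_neg, Phi_amplitude hI, Phi_amplitude hI]

theorem amplitude_add_int_mul {I : ℝ} (hI : 1 < I) (x : ℝ) (n : ℤ) :
    amplitude I (x + n * (2 * Phi I Real.pi)) = amplitude I x + n * (2 * Real.pi) := by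
  apply (strictMono_Phi hI).injective
  rw [Phi_add_int_mul_two_pi hI, Phi_amplitude hI, Phi_amplitude hI]

theorem abs_sin_half_amplitude {I : ℝ} (hI : 1 < I) (x : ℝ) :
    |Real.sin (amplitude I (x * (2 * Phi I Real.pi)) / 2)| =
      Real.sin (amplitude I (distNearestInt x * (2 * Phi I Real.pi)) / 2) := by
  have hK := Phi_pi_pos hI
  set L := 2 * Phi I Real.pi with hL
  set y := x - round x with hy
  have hyb : |y| ≤ 1 / 2 := abs_sub_round x
  have hxy : x * L = y * L + (round x : ℤ) * L := by rw [hy]; ring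
  have hnonneg : 0 ≤ amplitude I (|y| * L) := by
    rw [← amplitude_zero hI]
    exact (strictMono_amplitude hI).monotone (by positivity)
  have hle : amplitude I (|y| * L) ≤ Real.pi := by
    rw [← amplitude_Phi hI Real.pi]
    exact (strictMono_amplitude hI).monotone (by nlinarith)
  rw [hxy, amplitude_add_int_mul hI,
    show (amplitude I (y * L) + (round x : ℤ) * (2 * Real.pi)) / 2
      = amplitude I (y * L) / 2 + (round x : ℤ) * Real.pi by ring,
    Real.sin_add_int_mul_pi, abs_mul, abs_zpow, abs_neg, abs_one, one_zpow, one_mul,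
    show distNearestInt x = |y| from rfl,
    ← abs_of_nonneg (Real.sin_nonneg_of_nonneg_of_le_pi (x := amplitude I (|y| * L) / 2)
      (by linarith) (by linarith [Real.pi_pos]))]
  rcases abs_choice y with h | h <;> rw [h]
  rw [neg_mul, amplitude_neg hI, neg_div, Real.sin_neg, abs_neg]

theorem abs_sin_half_amplitude_le {I : ℝ} (hI : 1 < I) {x y : ℝ}
    (h : distNearestInt x ≤ distNearestInt y) :
    |Real.sin (amplitude I (x * (2 * Phi I Real.pi)) / 2)| ≤
      |Real.sin (amplitude I (y * (2 * Phi I Real.pi)) / 2)| := by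
  have hK := Phi_pi_pos hI
  rw [abs_sin_half_amplitude hI, abs_sin_half_amplitude hI]
  have hx : 0 ≤ distNearestInt x := abs_nonneg _
  have hy : distNearestInt y ≤ 1 / 2 := abs_sub_round y
  have h0 : 0 ≤ amplitude I (distNearestInt x * (2 * Phi I Real.pi)) := by
    rw [← amplitude_zero hI]
    exact (strictMono_amplitude hI).monotone (by positivity)
  have h1 : amplitude I (distNearestInt y * (2 * Phi I Real.pi)) ≤ Real.pi := by
    nth_rw 2 [← amplitude_Phi hI Real.pi]
    exact (strictMono_amplitude hI).monotone (by nlinarith)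
  have h2 : amplitude I (distNearestInt x * (2 * Phi I Real.pi)) ≤
      amplitude I (distNearestInt y * (2 * Phi I Real.pi)) :=
    (strictMono_amplitude hI).monotone (by gcongr)
  exact Real.sin_le_sin_of_le_of_le_pi_div_two (by linarith [Real.pi_pos]) (by linarith)
    (by linarith)

/-- Addition theorem for the elliptic sine `s` of modulus `κ` and its scaled derivative `p`. -/
theorem jacobi_add {s p : ℝ → ℝ} {l κ : ℝ} (hs : ∀ x, HasDerivAt s (l * p x) x)
    (hp : ∀ x, HasDerivAt p (l * (-(1 + κ ^ 2) * s x + 2 * κ ^ 2 * s x ^ 3)) x)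
    (hsq : ∀ x, p x ^ 2 = (1 - s x ^ 2) * (1 - κ ^ 2 * s x ^ 2))
    (hne : ∀ x y, 1 - κ ^ 2 * s x ^ 2 * s y ^ 2 ≠ 0) (hs0 : s 0 = 0) (hp0 : p 0 = 1) (x y : ℝ) :
    s (x + y) = (s x * p y + s y * p x) / (1 - κ ^ 2 * s x ^ 2 * s y ^ 2) := by
  set f : ℝ → ℝ := fun t => (s t * p (x + y - t) + s (x + y - t) * p t) /
    (1 - κ ^ 2 * s t ^ 2 * s (x + y - t) ^ 2) with hf
  have hd (t : ℝ) : HasDerivAt f 0 t := by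
    have hst := hs t
    have hpt := hp t
    have hsu := (hs (x + y - t)).comp_const_sub (x + y) t
    have hpu := (hp (x + y - t)).comp_const_sub (x + y) t
    have hN := (hst.mul hpu).add (hsu.mul hpt)
    have hD := (((hst.pow 2).const_mul (κ ^ 2)).mul (hsu.pow 2)).const_sub 1
    refine (hN.div hD (hne _ _)).congr_deriv ?_
    rw [div_eq_zero_iff]
    left
    have e1 := hsq t
    have e2 := hsq (x + y - t)
    simp only [Pi.mul_apply, Pi.add_apply, Pi.pow_apply]
    generalize s t = a at *
    generalize p t = b at *
    generalize s (x + y - t) = u at *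
    generalize p (x + y - t) = v at *
    push_cast
    linear_combination (2 * κ ^ 2 * l * a * u ^ 3) * e1 - (2 * κ ^ 2 * l * a ^ 3 * u) * e2
  have h := is_const_of_deriv_eq_zero (fun t => (hd t).differentiableAt) (fun t => (hd t).deriv) 0 x
  simpa [hf, hs0, hp0] using h

theorem jacobi_add_mul_sub {s p : ℝ → ℝ} {κ : ℝ}
    (hadd : ∀ x y, s (x + y) = (s x * p y + s y * p x) / (1 - κ ^ 2 * s x ^ 2 * s y ^ 2))
    (hsq : ∀ x, p x ^ 2 = (1 - s x ^ 2) * (1 - κ ^ 2 * s x ^ 2))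
    (hne : ∀ x y, 1 - κ ^ 2 * s x ^ 2 * s y ^ 2 ≠ 0)
    (hs : ∀ x, s (-x) = -s x) (hp : ∀ x, p (-x) = p x) (x y : ℝ) :
    s (x + y) * s (x - y) = (s x ^ 2 - s y ^ 2) / (1 - κ ^ 2 * s x ^ 2 * s y ^ 2) := by
  have h := hne x y
  have e1 := hsq x
  have e2 := hsq y
  rw [sub_eq_add_neg x y, hadd, hadd, hs, hp, neg_sq]
  generalize s x = a at *
  generalize p x = b at *
  generalize s y = u at *
  generalize p y = v at *
  rw [div_mul_div_comm, div_eq_div_iff (mul_ne_zero h h) h]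
  linear_combination (1 - κ ^ 2 * a ^ 2 * u ^ 2) * (a ^ 2 * e2 - u ^ 2 * e1)

/-- `√(2κ)` times the derivative of the amplitude. -/
noncomputable def ampSpeed (κ I x : ℝ) : ℝ := √(2 * κ) * √(I - Real.cos (amplitude I x))

/-- The elliptic sine of modulus `κ`, as a function of the amplitude
through the Landen transformation, where `κ ^ 2 + 1 = 2 * κ * I`. -/
noncomputable def landenSn (κ I x : ℝ) : ℝ :=
  2 * Real.sin (amplitude I x / 2) / (1 - κ + ampSpeed κ I x)

/-- The derivative of `landenSn`, up to a constant factor. -/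
noncomputable def landenSn' (κ I x : ℝ) : ℝ :=
  2 * (1 - κ) * Real.cos (amplitude I x / 2) / (1 - κ + ampSpeed κ I x)

theorem one_lt_of_sq_add_one_eq {κ I : ℝ} (h0 : 0 < κ) (h1 : κ < 1)
    (hκ : κ ^ 2 + 1 = 2 * κ * I) : 1 < I := by
  nlinarith [sq_pos_of_pos (sub_pos.2 h1)]

theorem ampSpeed_pos {κ I : ℝ} (h0 : 0 < κ) (hI : 1 < I) (x : ℝ) : 0 < ampSpeed κ I x := by
  have hpos : 0 < I - Real.cos (amplitude I x) := by
    linarith [Real.cos_le_one (amplitude I x)]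
  unfold ampSpeed
  positivity

theorem ampSpeed_sq {κ I : ℝ} (h0 : 0 < κ) (hI : 1 < I) (hκ : κ ^ 2 + 1 = 2 * κ * I) (x : ℝ) :
    ampSpeed κ I x ^ 2 = (1 - κ) ^ 2 + 4 * κ * Real.sin (amplitude I x / 2) ^ 2 := by
  have hpos : 0 ≤ I - Real.cos (amplitude I x) := by
    linarith [Real.cos_le_one (amplitude I x)]
  have hc := Real.cos_sq (amplitude I x / 2)
  rw [mul_div_cancel₀ _ (two_ne_zero)] at hc
  rw [ampSpeed, mul_pow, Real.sq_sqrt (by positivity), Real.sq_sqrt hpos, Real.sin_sq, hc]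
  linear_combination -hκ

theorem mul_landenSn_sq {κ I : ℝ} (h0 : 0 < κ) (h1 : κ < 1) (hκ : κ ^ 2 + 1 = 2 * κ * I) (x : ℝ) :
    κ * landenSn κ I x ^ 2 = 1 - 2 * (1 - κ) / (1 - κ + ampSpeed κ I x) := by
  have hI := one_lt_of_sq_add_one_eq h0 h1 hκ
  have hE := ampSpeed_pos h0 hI x
  have hE2 := ampSpeed_sq h0 hI hκ x
  have hne : 1 - κ + ampSpeed κ I x ≠ 0 := by linarith
  rw [landenSn]
  field_simp
  linear_combination -hE2

theorem mul_landenSn_sq_lt_one {κ I : ℝ} (h0 : 0 < κ) (h1 : κ < 1) (hκ : κ ^ 2 + 1 = 2 * κ * I)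
    (x : ℝ) : κ * landenSn κ I x ^ 2 < 1 := by
  have hE := ampSpeed_pos h0 (one_lt_of_sq_add_one_eq h0 h1 hκ) x
  have h2 : 0 < 1 - κ := sub_pos.2 h1
  rw [mul_landenSn_sq h0 h1 hκ, sub_lt_self_iff]
  positivity

theorem landenSn_denom_pos {κ I : ℝ} (h0 : 0 < κ) (h1 : κ < 1) (hκ : κ ^ 2 + 1 = 2 * κ * I)
    (x y : ℝ) : 0 < 1 - κ ^ 2 * landenSn κ I x ^ 2 * landenSn κ I y ^ 2 := by
  have hx := mul_landenSn_sq_lt_one h0 h1 hκ x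
  have hy := mul_landenSn_sq_lt_one h0 h1 hκ y
  have := mul_lt_one_of_nonneg_of_lt_one_left (by positivity) hx hy.le
  linarith

theorem landenSn'_sq {κ I : ℝ} (h0 : 0 < κ) (h1 : κ < 1) (hκ : κ ^ 2 + 1 = 2 * κ * I) (x : ℝ) :
    landenSn' κ I x ^ 2 = (1 - landenSn κ I x ^ 2) * (1 - κ ^ 2 * landenSn κ I x ^ 2) := by
  have hs := Real.sin_sq_add_cos_sq (amplitude I x / 2)
  have hκs := mul_landenSn_sq h0 h1 hκ x
  have hform : 1 - κ * landenSn κ I x ^ 2 = 2 * (1 - κ) / (1 - κ + ampSpeed κ I x) := by linarith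
  have hS : (1 - κ * landenSn κ I x ^ 2) * Real.sin (amplitude I x / 2)
      = (1 - κ) * landenSn κ I x := by
    rw [hform, landenSn]; ring
  have hC : landenSn' κ I x = (1 - κ * landenSn κ I x ^ 2) * Real.cos (amplitude I x / 2) := by
    rw [hform, landenSn']; ring
  rw [hC]
  linear_combination (1 - κ * landenSn κ I x ^ 2) ^ 2 * hs
    - ((1 - κ * landenSn κ I x ^ 2) * Real.sin (amplitude I x / 2)
      + (1 - κ) * landenSn κ I x) * hS

theorem hasDerivAt_sin_half_amplitude {κ I : ℝ} (h0 : 0 < κ) (hI : 1 < I) (x : ℝ) :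
    HasDerivAt (fun x => Real.sin (amplitude I x / 2))
      (1 / (2 * √(2 * κ)) * (Real.cos (amplitude I x / 2) * ampSpeed κ I x)) x := by
  have hq : √(2 * κ) ≠ 0 := (Real.sqrt_pos.2 (by positivity)).ne'
  refine ((hasDerivAt_amplitude hI x).div_const 2).sin.congr_deriv ?_
  rw [ampSpeed]
  field_simp

theorem hasDerivAt_cos_half_amplitude {κ I : ℝ} (h0 : 0 < κ) (hI : 1 < I) (x : ℝ) :
    HasDerivAt (fun x => Real.cos (amplitude I x / 2))
      (1 / (2 * √(2 * κ)) * (-Real.sin (amplitude I x / 2) * ampSpeed κ I x)) x := by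
  have hq : √(2 * κ) ≠ 0 := (Real.sqrt_pos.2 (by positivity)).ne'
  refine ((hasDerivAt_amplitude hI x).div_const 2).cos.congr_deriv ?_
  rw [ampSpeed]
  field_simp

theorem hasDerivAt_ampSpeed {κ I : ℝ} (h0 : 0 < κ) (hI : 1 < I) (x : ℝ) :
    HasDerivAt (ampSpeed κ I) (1 / (2 * √(2 * κ)) *
      (4 * κ * Real.sin (amplitude I x / 2) * Real.cos (amplitude I x / 2))) x := by
  have hq : √(2 * κ) ≠ 0 := (Real.sqrt_pos.2 (by positivity)).ne'
  have hq2 : √(2 * κ) ^ 2 = 2 * κ := Real.sq_sqrt (by positivity)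
  have hpos : 0 < I - Real.cos (amplitude I x) := by
    linarith [Real.cos_le_one (amplitude I x)]
  have hD : √(I - Real.cos (amplitude I x)) ≠ 0 := (Real.sqrt_pos.2 hpos).ne'
  have hsin := Real.sin_two_mul (amplitude I x / 2)
  rw [mul_div_cancel₀ _ (two_ne_zero)] at hsin
  refine ((((hasDerivAt_amplitude hI x).cos.const_sub I).sqrt hpos.ne').const_mul
    √(2 * κ)).congr_deriv ?_
  rw [hsin]
  field_simp
  linear_combination (2 * Real.sin (amplitude I x / 2) * Real.cos (amplitude I x / 2)) * hq2

theorem hasDerivAt_landenSn {κ I : ℝ} (h0 : 0 < κ) (h1 : κ < 1) (hκ : κ ^ 2 + 1 = 2 * κ * I)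
    (x : ℝ) :
    HasDerivAt (landenSn κ I) (1 / (2 * √(2 * κ)) * landenSn' κ I x) x := by
  have hI := one_lt_of_sq_add_one_eq h0 h1 hκ
  have hE := ampSpeed_pos h0 hI x
  have hE2 := ampSpeed_sq h0 hI hκ x
  have hne : 1 - κ + ampSpeed κ I x ≠ 0 := by linarith
  refine (((hasDerivAt_sin_half_amplitude h0 hI x).const_mul 2).div
    ((hasDerivAt_ampSpeed h0 hI x).const_add (1 - κ)) hne).congr_deriv ?_
  rw [landenSn']
  generalize 1 / (2 * √(2 * κ)) = l
  field_simp
  linear_combination (l * Real.cos (amplitude I x / 2)) * hE2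

theorem hasDerivAt_landenSn' {κ I : ℝ} (h0 : 0 < κ) (h1 : κ < 1) (hκ : κ ^ 2 + 1 = 2 * κ * I)
    (x : ℝ) :
    HasDerivAt (landenSn' κ I) (1 / (2 * √(2 * κ)) *
      (-(1 + κ ^ 2) * landenSn κ I x + 2 * κ ^ 2 * landenSn κ I x ^ 3)) x := by
  have hI := one_lt_of_sq_add_one_eq h0 h1 hκ
  have hE := ampSpeed_pos h0 hI x
  have hE2 := ampSpeed_sq h0 hI hκ x
  have hne : 1 - κ + ampSpeed κ I x ≠ 0 := by linarith
  have hcs := Real.cos_sq' (amplitude I x / 2)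
  refine (((hasDerivAt_cos_half_amplitude h0 hI x).const_mul (2 * (1 - κ))).div
    ((hasDerivAt_ampSpeed h0 hI x).const_add (1 - κ)) hne).congr_deriv ?_
  rw [landenSn]
  generalize 1 / (2 * √(2 * κ)) = l
  field_simp
  linear_combination (-4 * (1 - κ) * κ * l * Real.sin (amplitude I x / 2) *
      (1 - κ + ampSpeed κ I x)) * hcs +
    l * Real.sin (amplitude I x / 2) * (2 * κ - (1 - κ) * (1 - κ + ampSpeed κ I x)) * hE2

theorem landenSn_neg {κ I : ℝ} (hI : 1 < I) (x : ℝ) : landenSn κ I (-x) = -landenSn κ I x := by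
  rw [landenSn, landenSn, ampSpeed, ampSpeed, amplitude_neg hI, neg_div, Real.sin_neg,
    Real.cos_neg, mul_neg, neg_div]

theorem landenSn'_neg {κ I : ℝ} (hI : 1 < I) (x : ℝ) : landenSn' κ I (-x) = landenSn' κ I x := by
  rw [landenSn', landenSn', ampSpeed, ampSpeed, amplitude_neg hI, neg_div, Real.cos_neg,
    Real.cos_neg]

theorem landenSn_add {κ I : ℝ} (h0 : 0 < κ) (h1 : κ < 1) (hκ : κ ^ 2 + 1 = 2 * κ * I) (x y : ℝ) :
    landenSn κ I (x + y) = (landenSn κ I x * landenSn' κ I y + landenSn κ I y * landenSn' κ I x) /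
      (1 - κ ^ 2 * landenSn κ I x ^ 2 * landenSn κ I y ^ 2) := by
  have hI := one_lt_of_sq_add_one_eq h0 h1 hκ
  have hE := ampSpeed_pos h0 hI 0
  have hE2 := ampSpeed_sq h0 hI hκ 0
  rw [amplitude_zero hI] at hE2
  have hE0 : ampSpeed κ I 0 = 1 - κ := by
    refine (sq_eq_sq₀ hE.le (by linarith)).1 ?_
    simpa using hE2
  refine jacobi_add (hasDerivAt_landenSn h0 h1 hκ) (hasDerivAt_landenSn' h0 h1 hκ)
    (landenSn'_sq h0 h1 hκ) (fun x y => (landenSn_denom_pos h0 h1 hκ x y).ne') ?_ ?_ x y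
  · simp [landenSn, amplitude_zero hI]
  · have : 1 - κ ≠ 0 := by linarith
    rw [landenSn', hE0, amplitude_zero hI, zero_div, Real.cos_zero]
    field_simp
    norm_num

theorem landenSn_add_mul_sub {κ I : ℝ} (h0 : 0 < κ) (h1 : κ < 1) (hκ : κ ^ 2 + 1 = 2 * κ * I)
    (x y : ℝ) :
    landenSn κ I (x + y) * landenSn κ I (x - y) = (landenSn κ I x ^ 2 - landenSn κ I y ^ 2) /
      (1 - κ ^ 2 * landenSn κ I x ^ 2 * landenSn κ I y ^ 2) :=
  have hI := one_lt_of_sq_add_one_eq h0 h1 hκ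
  jacobi_add_mul_sub (landenSn_add h0 h1 hκ) (landenSn'_sq h0 h1 hκ)
    (fun x y => (landenSn_denom_pos h0 h1 hκ x y).ne') (landenSn_neg hI) (landenSn'_neg hI) x y

theorem abs_landenSn_le {κ I : ℝ} (h0 : 0 < κ) (h1 : κ < 1) (hκ : κ ^ 2 + 1 = 2 * κ * I) {x y : ℝ}
    (h : |Real.sin (amplitude I x / 2)| ≤ |Real.sin (amplitude I y / 2)|) :
    |landenSn κ I x| ≤ |landenSn κ I y| := by
  have hI := one_lt_of_sq_add_one_eq h0 h1 hκ
  have hx := ampSpeed_pos h0 hI x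
  have hy := ampSpeed_pos h0 hI y
  have hle : ampSpeed κ I x ≤ ampSpeed κ I y := by
    refine (sq_le_sq₀ hx.le hy.le).1 ?_
    rw [ampSpeed_sq h0 hI hκ, ampSpeed_sq h0 hI hκ]
    have := sq_le_sq.2 h
    gcongr
  have ha : 0 < 1 - κ := sub_pos.2 h1
  refine sq_le_sq.1 (le_of_mul_le_mul_left ?_ h0)
  rw [mul_landenSn_sq h0 h1 hκ, mul_landenSn_sq h0 h1 hκ]
  gcongr

theorem landenSn_int_mul_ne_zero {κ I φ : ℝ} (h0 : 0 < κ) (h1 : κ < 1)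
    (hκ : κ ^ 2 + 1 = 2 * κ * I) {k : ℕ} (hk : k ≠ 0)
    (hirr : Irrational (Phi I φ / (2 * Phi I Real.pi))) :
    landenSn κ I (k * Phi I φ) ≠ 0 := by
  have hI := one_lt_of_sq_add_one_eq h0 h1 hκ
  have hK := Phi_pi_pos hI
  have hE := ampSpeed_pos h0 hI (k * Phi I φ)
  have hne : 1 - κ + ampSpeed κ I (k * Phi I φ) ≠ 0 := by linarith
  intro h
  have hsin : Real.sin (amplitude I (k * Phi I φ) / 2) = 0 := by
    simpa [landenSn, hne] using h
  obtain ⟨n, hn⟩ := Real.sin_eq_zero_iff.1 hsin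
  have hφ : amplitude I (k * Phi I φ) = 0 + n * (2 * Real.pi) := by linarith
  have hΦ := congrArg (Phi I) hφ
  rw [Phi_amplitude hI, Phi_add_int_mul_two_pi hI, Phi_zero, zero_add] at hΦ
  refine (hirr.natCast_mul hk).ne_int n ?_
  rw [← mul_div_assoc, hΦ]
  field_simp

/-- The recurrence is solved by quotients of elliptic sines. -/
theorem eq_abs_landenSn_div {κ I c x : ℝ} {γ : ℕ → ℝ} (h0 : 0 < κ) (h1 : κ < 1)
    (hκ : κ ^ 2 + 1 = 2 * κ * I) (hs : 0 < landenSn κ I x) (hp : 0 < landenSn' κ I x)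
    (hc : κ * landenSn κ I x ^ 2 = c) (hne : ∀ k : ℕ, k ≠ 0 → landenSn κ I (k * x) ≠ 0)
    (hγ1 : γ 1 = 1) (hγ2 : γ 2 = 2 * landenSn' κ I x / (1 - c ^ 2))
    (hγrec : ∀ k : ℕ, 2 ≤ k →
      γ (k + 1) = |1 - γ k ^ 2| / (γ (k - 1) * (1 - c ^ 2 * γ k ^ 2))) (k : ℕ) (hk : 1 ≤ k) :
    γ k = |landenSn κ I (k * x)| / landenSn κ I x := by
  induction k using Nat.strong_induction_on with
  | _ k ih =>
  match k, hk with
  | 1, _ => simp [hγ1, abs_of_pos hs, hs.ne']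
  | 2, _ =>
    have hd := landenSn_denom_pos h0 h1 hκ x x
    have hd' : κ ^ 2 * landenSn κ I x ^ 2 * landenSn κ I x ^ 2 = c ^ 2 := by rw [← hc]; ring
    push_cast
    rw [hd'] at hd
    rw [two_mul, landenSn_add h0 h1 hκ, hγ2, hd', abs_of_pos (by positivity)]
    field_simp
    ring
  | n + 3, _ =>
    have ha := ih (n + 2) (by omega) (by omega)
    have hb := ih (n + 1) (by omega) (by omega)
    have hd := landenSn_denom_pos h0 h1 hκ ((n + 2 : ℕ) * x) x
    have h := landenSn_add_mul_sub h0 h1 hκ ((n + 2 : ℕ) * x) x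
    have hn := hne (n + 1) (by omega)
    rw [show (n + 2 : ℕ) * x + x = (n + 3 : ℕ) * x by push_cast; ring,
      show (n + 2 : ℕ) * x - x = (n + 1 : ℕ) * x by push_cast; ring] at h
    rw [hγrec (n + 2) (by omega), show n + 2 - 1 = n + 1 by omega, ha, hb, ← hc]
    have habs := congrArg abs h
    rw [abs_mul, abs_div, abs_of_pos hd] at habs
    have hn' := abs_pos.2 hn
    rw [div_pow, sq_abs]
    generalize landenSn κ I ((n + 3 : ℕ) * x) = A at *
    generalize landenSn κ I ((n + 2 : ℕ) * x) = B at *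
    generalize landenSn κ I ((n + 1 : ℕ) * x) = D at *
    generalize landenSn κ I x = s at *
    have e1 : 1 - B ^ 2 / s ^ 2 = -((B ^ 2 - s ^ 2) / s ^ 2) := by field_simp; ring
    have e2 : 1 - (κ * s ^ 2) ^ 2 * (B ^ 2 / s ^ 2) = 1 - κ ^ 2 * B ^ 2 * s ^ 2 := by
      field_simp
    rw [e1, e2, abs_neg, abs_div, abs_of_pos (by positivity : 0 < s ^ 2)]
    rw [eq_div_iff hd.ne'] at habs
    rw [← habs]
    have := hd.ne'
    have := hn'.ne'
    field_simp

theorem landenSn_parameters {κ I c r φ : ℝ} (h0 : 0 < κ) (h1 : κ < 1)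
    (hκ : κ ^ 2 + 1 = 2 * κ * I) (hc : 0 < c) (hr : 0 < r) (hcr : c + r < 1)
    (hI : I = (1 + c ^ 2 - r ^ 2) / (2 * c)) (hφ : φ ∈ Set.Ioo 0 Real.pi)
    (hcos : Real.cos φ = 2 * r ^ 2 / (1 - c) ^ 2 - 1) :
    0 < landenSn κ I (Phi I φ) ∧ κ * landenSn κ I (Phi I φ) ^ 2 = c ∧
      landenSn' κ I (Phi I φ) = r := by
  have hI1 := one_lt_of_sq_add_one_eq h0 h1 hκ
  have hE := ampSpeed_pos h0 hI1 (Phi I φ)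
  have hE2 := ampSpeed_sq h0 hI1 hκ (Phi I φ)
  have hms := mul_landenSn_sq h0 h1 hκ (Phi I φ)
  have ha : 0 < 1 - κ := sub_pos.2 h1
  have hc1 : 0 < 1 - c := by linarith
  rw [amplitude_Phi hI1] at hE2
  have hS : 0 < Real.sin (φ / 2) :=
    Real.sin_pos_of_pos_of_lt_pi (by linarith [hφ.1]) (by linarith [hφ.1, hφ.2])
  have hC : Real.cos (φ / 2) = r / (1 - c) := by
    have hC0 : 0 < Real.cos (φ / 2) :=
      Real.cos_pos_of_mem_Ioo ⟨by linarith [hφ.1, Real.pi_pos], by linarith [hφ.2]⟩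
    refine (sq_eq_sq₀ hC0.le (by positivity)).1 ?_
    rw [Real.cos_sq, mul_div_cancel₀ _ two_ne_zero, hcos, div_pow]
    ring
  have hEv : ampSpeed κ I (Phi I φ) = (1 - κ) * (1 + c) / (1 - c) := by
    refine (sq_eq_sq₀ hE.le (by positivity)).1 ?_
    rw [hE2, Real.sin_sq, hC]
    rw [hI] at hκ
    field_simp at hκ ⊢
    linear_combination -4 * hκ
  have hden : 1 - κ + ampSpeed κ I (Phi I φ) = 2 * (1 - κ) / (1 - c) := by
    rw [hEv]; field_simp; ring
  refine ⟨?_, ?_, ?_⟩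
  · rw [landenSn, amplitude_Phi hI1]
    positivity
  · rw [hms, hden]
    field_simp
    ring
  · rw [landenSn', amplitude_Phi hI1, hden, hC]
    field_simp

theorem exists_modulus {I : ℝ} (hI : 1 < I) : ∃ κ : ℝ, 0 < κ ∧ κ < 1 ∧ κ ^ 2 + 1 = 2 * κ * I := by
  have h := Real.sq_sqrt (show 0 ≤ I ^ 2 - 1 by nlinarith)
  have hs := Real.sqrt_nonneg (I ^ 2 - 1)
  refine ⟨I - √(I ^ 2 - 1), by nlinarith, by nlinarith, by linear_combination h⟩

theorem stmt4 (c r : ℝ) (hc : 0 < c) (hr : 0 < r) (hcr : c + r < 1)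
    (I : ℝ) (hI : I = (1 + c ^ 2 - r ^ 2) / (2 * c))
    (φ₁ : ℝ) (hφ₁ : φ₁ ∈ Set.Ioo 0 Real.pi)
    (hcos : Real.cos φ₁ = 2 * r ^ 2 / (1 - c) ^ 2 - 1)
    (γ : ℕ → ℝ) (hγ1 : γ 1 = 1) (hγ2 : γ 2 = 2 * r / (1 - c ^ 2))
    (hγrec : ∀ k : ℕ, 2 ≤ k →
      γ (k + 1) = |1 - γ k ^ 2| / (γ (k - 1) * (1 - c ^ 2 * γ k ^ 2)))
    (θ : ℝ) (hθ : θ = Phi I φ₁ / (2 * Phi I Real.pi))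
    (hirr : Irrational θ) :
    ∀ k : ℕ, 2 ≤ k → (∀ m : ℕ, 1 ≤ m → m < k → γ k < γ m) →
      ∃ p : ℤ, IsBestApprox θ p k := by
  have hI1 : 1 < I := by
    rw [hI, lt_div_iff₀ (by positivity)]
    nlinarith [mul_pos (sub_pos.2 hcr) (show 0 < 1 - c + r by linarith)]
  obtain ⟨κ, h0, h1, hκ⟩ := exists_modulus hI1
  obtain ⟨hs, hsc, hp⟩ := landenSn_parameters h0 h1 hκ hc hr hcr hI hφ₁ hcos
  have hK := Phi_pi_pos hI1
  have hγ := eq_abs_landenSn_div h0 h1 hκ hs (hp ▸ hr) hsc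
    (fun k hk => landenSn_int_mul_ne_zero h0 h1 hκ hk (hθ ▸ hirr)) hγ1 (hp ▸ hγ2) hγrec
  have hx (k : ℕ) : (k : ℝ) * Phi I φ₁ = k * θ * (2 * Phi I Real.pi) := by
    rw [hθ]
    field_simp
  intro k hk hmin
  refine ⟨round (k * θ), by omega, by simp [distNearestInt], fun j hj hjk => ?_⟩
  lift j to ℕ using by omega
  by_contra! hle
  have hlt := hmin j (by omega) (by omega)
  rw [hγ k (by omega), hγ j (by omega), div_lt_div_iff_of_pos_right hs, hx, hx] at hlt
  refine hlt.not_ge (abs_landenSn_le h0 h1 hκ (abs_sin_half_amplitude_le hI1 ?_))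
  exact_mod_cast hle
end

section
/- Suppose the real numbers φ₁ < ψ₁ < φ₁ + 2π and φ₂ < ψ₂ < φ₂ + 2π are such that for i = 1, 2 the line through the points e^{iφ_i} and e^{iψ_i} is tangent to the circle {ζ ∈ ℂ : |ζ − c| = r} and the center c lies to the left of the chord directed from e^{iφ_i} to e^{iψ_i}, i.e. Im((e^{iψ_i} − e^{iφ_i})·conj(c − e^{iφ_i})) > 0. Then ∫_{φ₁}^{ψ₁} dt/√(I − cos t) = ∫_{φ₂}^{ψ₂} dt/√(I − cos t). -/
open MeasureTheory

/-- The line through `z` and `w` is tangent to the circle of center `c` and radius `r`: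
the infimum of the distances from the points of the line to `c` equals `r`. -/
noncomputable def IsTangentLine (c : ℂ) (r : ℝ) (z w : ℂ) : Prop :=
  (⨅ t : ℝ, dist (z + (t : ℂ) * (w - z)) c) = r

/-- Half the angle of the arc with midpoint `exp (m * I)` cut off by the tangent to the circle
of center `c` and radius `r`, when that arc lies on the same side of the tangent as `c`. -/
noncomputable def chordHalfAngle (c r m : ℝ) : ℝ := Real.arccos (c * Real.cos m - r)

lemma one_lt_of_nested {c r I : ℝ} (hc : 0 < c) (hr : 0 < r) (hcr : c + r < 1)
    (hI : I = (1 + c ^ 2 - r ^ 2) / (2 * c)) : 1 < I := by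
  rw [hI, lt_div_iff₀ (by positivity)]
  nlinarith

lemma exp_sub_mul_I (m d : ℝ) : Complex.exp (((m - d : ℝ) : ℂ) * Complex.I) =
    ⟨Real.cos m * Real.cos d + Real.sin m * Real.sin d,
      Real.sin m * Real.cos d - Real.cos m * Real.sin d⟩ := by
  apply Complex.ext
  · rw [Complex.exp_ofReal_mul_I_re, Real.cos_sub]
  · rw [Complex.exp_ofReal_mul_I_im, Real.sin_sub]

lemma exp_add_mul_I (m d : ℝ) : Complex.exp (((m + d : ℝ) : ℂ) * Complex.I) =
    ⟨Real.cos m * Real.cos d - Real.sin m * Real.sin d,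
      Real.sin m * Real.cos d + Real.cos m * Real.sin d⟩ := by
  apply Complex.ext
  · rw [Complex.exp_ofReal_mul_I_re, Real.cos_add]
  · rw [Complex.exp_ofReal_mul_I_im, Real.sin_add]

lemma dist_chord_point (c m d t : ℝ) :
    dist (Complex.exp (((m - d : ℝ) : ℂ) * Complex.I) + (t : ℂ) *
      (Complex.exp (((m + d : ℝ) : ℂ) * Complex.I) -
        Complex.exp (((m - d : ℝ) : ℂ) * Complex.I))) (c : ℂ) =
    Real.sqrt ((c * Real.cos m - Real.cos d) ^ 2 +
      (Real.sin d * (2 * t - 1) + c * Real.sin m) ^ 2) := by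
  rw [exp_sub_mul_I, exp_add_mul_I, Complex.dist_eq, Complex.norm_def, Complex.normSq_apply]
  congr 1
  simp only [Complex.sub_re, Complex.sub_im, Complex.add_re, Complex.add_im, Complex.mul_re,
    Complex.mul_im, Complex.ofReal_re, Complex.ofReal_im]
  linear_combination (Real.cos d ^ 2 + Real.sin d ^ 2 * (1 - 2 * t) ^ 2 - c ^ 2) *
    Real.sin_sq_add_cos_sq m

lemma iInf_dist_chord (c m d : ℝ) (hd : Real.sin d ≠ 0) :
    (⨅ t : ℝ, dist (Complex.exp (((m - d : ℝ) : ℂ) * Complex.I) + (t : ℂ) *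
      (Complex.exp (((m + d : ℝ) : ℂ) * Complex.I) -
        Complex.exp (((m - d : ℝ) : ℂ) * Complex.I))) (c : ℂ)) =
    |c * Real.cos m - Real.cos d| := by
  simp_rw [dist_chord_point]
  apply le_antisymm
  · refine (ciInf_le ⟨0, ?_⟩ ((1 - c * Real.sin m / Real.sin d) / 2)).trans_eq ?_
    · rintro _ ⟨t, rfl⟩
      positivity
    · rw [← Real.sqrt_sq_eq_abs]
      congr 1
      field_simp
      ring
  · refine le_ciInf fun t => ?_
    rw [← Real.sqrt_sq_eq_abs]
    exact Real.sqrt_le_sqrt (le_add_of_nonneg_right (sq_nonneg _))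

lemma im_chord_mul_conj (c m d : ℝ) :
    ((Complex.exp (((m + d : ℝ) : ℂ) * Complex.I) -
      Complex.exp (((m - d : ℝ) : ℂ) * Complex.I)) *
      (starRingEnd ℂ) ((c : ℂ) - Complex.exp (((m - d : ℝ) : ℂ) * Complex.I))).im =
    2 * Real.sin d * (c * Real.cos m - Real.cos d) := by
  rw [exp_sub_mul_I, exp_add_mul_I]
  simp only [Complex.sub_re, Complex.sub_im, Complex.mul_im, Complex.conj_re, Complex.conj_im,
    Complex.ofReal_re, Complex.ofReal_im]
  linear_combination (-2 * Real.sin d * Real.cos d) * Real.sin_sq_add_cos_sq m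

lemma cos_half_sub_of_isTangentLine {c r φ ψ : ℝ} (hl : φ < ψ) (hu : ψ < φ + 2 * Real.pi)
    (htan : IsTangentLine (c : ℂ) r
      (Complex.exp ((φ : ℂ) * Complex.I)) (Complex.exp ((ψ : ℂ) * Complex.I)))
    (hside : 0 < ((Complex.exp ((ψ : ℂ) * Complex.I) - Complex.exp ((φ : ℂ) * Complex.I)) *
      (starRingEnd ℂ) ((c : ℂ) - Complex.exp ((φ : ℂ) * Complex.I))).im) :
    Real.cos ((ψ - φ) / 2) = c * Real.cos ((φ + ψ) / 2) - r := by
  have hs : 0 < Real.sin ((ψ - φ) / 2) :=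
    Real.sin_pos_of_pos_of_lt_pi (by linarith) (by linarith)
  obtain ⟨m, hm⟩ : ∃ m, m = (φ + ψ) / 2 := ⟨_, rfl⟩
  obtain ⟨d, hd⟩ : ∃ d, d = (ψ - φ) / 2 := ⟨_, rfl⟩
  have hφ : φ = m - d := by rw [hm, hd]; ring
  have hψ : ψ = m + d := by rw [hm, hd]; ring
  rw [← hd] at hs
  rw [← hd, ← hm]
  rw [hφ, hψ] at htan hside
  rw [IsTangentLine, iInf_dist_chord c m d hs.ne'] at htan
  rw [im_chord_mul_conj] at hside
  rw [abs_of_pos (pos_of_mul_pos_right hside (by positivity))] at htan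
  linarith

lemma eq_chordHalfAngle {c r φ ψ : ℝ} (hl : φ < ψ) (hu : ψ < φ + 2 * Real.pi)
    (h : Real.cos ((ψ - φ) / 2) = c * Real.cos ((φ + ψ) / 2) - r) :
    φ = (φ + ψ) / 2 - chordHalfAngle c r ((φ + ψ) / 2) ∧
      ψ = (φ + ψ) / 2 + chordHalfAngle c r ((φ + ψ) / 2) := by
  rw [chordHalfAngle, ← h, Real.arccos_cos (by linarith) (by linarith)]
  constructor <;> ring

lemma abs_cos_chord_lt_one {c r : ℝ} (hc : 0 < c) (hr : 0 < r) (hcr : c + r < 1) (m : ℝ) :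
    -1 < c * Real.cos m - r ∧ c * Real.cos m - r < 1 := by
  constructor <;> nlinarith [Real.neg_one_le_cos m, Real.cos_le_one m]

lemma hasDerivAt_chordHalfAngle {c r : ℝ} (hc : 0 < c) (hr : 0 < r) (hcr : c + r < 1) (m : ℝ) :
    HasDerivAt (chordHalfAngle c r)
      (c * Real.sin m / Real.sin (chordHalfAngle c r m)) m := by
  obtain ⟨h1, h2⟩ := abs_cos_chord_lt_one hc hr hcr m
  have h := (Real.hasDerivAt_arccos h1.ne' h2.ne).comp m
    (((Real.hasDerivAt_cos m).const_mul c).sub_const r)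
  refine h.congr_deriv ?_
  rw [chordHalfAngle, Real.sin_arccos]
  ring

lemma abs_sin_lt_sin_chordHalfAngle {c r : ℝ} (hc : 0 < c) (hr : 0 < r) (hcr : c + r < 1)
    (m : ℝ) : |c * Real.sin m| < Real.sin (chordHalfAngle c r m) := by
  rw [chordHalfAngle, Real.sin_arccos]
  apply Real.lt_sqrt_of_sq_lt
  rw [sq_abs]
  have hlt : (c + r) ^ 2 < 1 := by nlinarith
  have hcos : 0 ≤ c * r * (Real.cos m + 1) :=
    mul_nonneg (mul_pos hc hr).le (by linarith [Real.neg_one_le_cos m])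
  rw [mul_pow, Real.sin_sq]
  linarith

lemma chord_endpoint_speeds {c r I : ℝ} (hc : 0 < c) (hr : 0 < r) (hcr : c + r < 1)
    (hI : I = (1 + c ^ 2 - r ^ 2) / (2 * c)) (m : ℝ) :
    (1 / Real.sqrt (I - Real.cos (m + chordHalfAngle c r m))) *
      (1 + c * Real.sin m / Real.sin (chordHalfAngle c r m)) =
    (1 / Real.sqrt (I - Real.cos (m - chordHalfAngle c r m))) *
      (1 - c * Real.sin m / Real.sin (chordHalfAngle c r m)) := by
  have hI1 := one_lt_of_nested hc hr hcr hI
  have habs := abs_sin_lt_sin_chordHalfAngle hc hr hcr m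
  obtain ⟨hlo, hhi⟩ := abs_lt.mp habs
  have hs : 0 < Real.sin (chordHalfAngle c r m) := (abs_nonneg _).trans_lt habs
  have hk : Real.cos (chordHalfAngle c r m) = c * Real.cos m - r := by
    obtain ⟨h1, h2⟩ := abs_cos_chord_lt_one hc hr hcr m
    rw [chordHalfAngle, Real.cos_arccos h1.le h2.le]
  generalize chordHalfAngle c r m = d at *
  have hp : 0 < I - Real.cos (m + d) := by linarith [Real.cos_le_one (m + d)]
  have hq : 0 < I - Real.cos (m - d) := by linarith [Real.cos_le_one (m - d)]
  have hIc : 2 * c * I = 1 + c ^ 2 - r ^ 2 := by rw [hI]; field_simp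
  have hsq : (Real.sin d + c * Real.sin m) ^ 2 * (I - Real.cos (m - d)) =
      (Real.sin d - c * Real.sin m) ^ 2 * (I - Real.cos (m + d)) := by
    rw [Real.cos_sub, Real.cos_add]
    have e : 2 * c * (I - Real.cos m * Real.cos d) =
        Real.sin d ^ 2 + c ^ 2 * Real.sin m ^ 2 := by
      rw [Real.sin_sq d, Real.sin_sq m, hk]
      linear_combination hIc
    linear_combination 2 * Real.sin d * Real.sin m * e
  have hroot : (Real.sin d + c * Real.sin m) * Real.sqrt (I - Real.cos (m - d)) =
      (Real.sin d - c * Real.sin m) * Real.sqrt (I - Real.cos (m + d)) := by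
    rw [← sq_eq_sq₀ (mul_nonneg (by linarith) (Real.sqrt_nonneg _))
      (mul_nonneg (by linarith) (Real.sqrt_nonneg _)), mul_pow, mul_pow,
      Real.sq_sqrt hq.le, Real.sq_sqrt hp.le, hsq]
  have hp' := Real.sqrt_pos.mpr hp
  have hq' := Real.sqrt_pos.mpr hq
  field_simp
  linear_combination hroot

lemma integral_chord_const {c r I : ℝ} (hc : 0 < c) (hr : 0 < r) (hcr : c + r < 1)
    (hI : I = (1 + c ^ 2 - r ^ 2) / (2 * c)) (m n : ℝ) :
    (∫ t in (m - chordHalfAngle c r m)..(m + chordHalfAngle c r m),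
      1 / Real.sqrt (I - Real.cos t)) =
    ∫ t in (n - chordHalfAngle c r n)..(n + chordHalfAngle c r n),
      1 / Real.sqrt (I - Real.cos t) := by
  have hI1 := one_lt_of_nested hc hr hcr hI
  have hcont : Continuous fun t : ℝ => 1 / Real.sqrt (I - Real.cos t) := by
    refine continuous_const.div (by fun_prop) fun t => ?_
    exact (Real.sqrt_pos.mpr (by linarith [Real.cos_le_one t])).ne'
  have hprim (x : ℝ) := (hcont.integral_hasStrictDerivAt 0 x).hasDerivAt
  have hderiv (x : ℝ) : HasDerivAt (fun m => ∫ t in (m - chordHalfAngle c r m)..(m +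
      chordHalfAngle c r m), 1 / Real.sqrt (I - Real.cos t)) 0 x := by
    have hd := hasDerivAt_chordHalfAngle hc hr hcr x
    have h := ((hprim _).comp x ((hasDerivAt_id x).add hd)).sub
      ((hprim _).comp x ((hasDerivAt_id x).sub hd))
    refine (h.congr_deriv (sub_eq_zero.mpr ?_)).congr_of_eventuallyEq
      (Filter.Eventually.of_forall fun y => ?_)
    · exact chord_endpoint_speeds hc hr hcr hI x
    · exact (intervalIntegral.integral_interval_sub_left (hcont.intervalIntegrable _ _)
        (hcont.intervalIntegrable _ _)).symm
  exact is_const_of_deriv_eq_zero (fun x => (hderiv x).differentiableAt)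
    (fun x => (hderiv x).deriv) m n

theorem stmt6 (c r : ℝ) (hc : 0 < c) (hr : 0 < r) (hcr : c + r < 1)
    (I : ℝ) (hI : I = (1 + c ^ 2 - r ^ 2) / (2 * c))
    (φ₁ ψ₁ φ₂ ψ₂ : ℝ)
    (h1l : φ₁ < ψ₁) (h1r : ψ₁ < φ₁ + 2 * Real.pi)
    (h2l : φ₂ < ψ₂) (h2r : ψ₂ < φ₂ + 2 * Real.pi)
    (htan1 : IsTangentLine (c : ℂ) r
      (Complex.exp ((φ₁ : ℂ) * Complex.I)) (Complex.exp ((ψ₁ : ℂ) * Complex.I)))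
    (htan2 : IsTangentLine (c : ℂ) r
      (Complex.exp ((φ₂ : ℂ) * Complex.I)) (Complex.exp ((ψ₂ : ℂ) * Complex.I)))
    (hside1 : 0 < ((Complex.exp ((ψ₁ : ℂ) * Complex.I) - Complex.exp ((φ₁ : ℂ) * Complex.I)) *
      (starRingEnd ℂ) ((c : ℂ) - Complex.exp ((φ₁ : ℂ) * Complex.I))).im)
    (hside2 : 0 < ((Complex.exp ((ψ₂ : ℂ) * Complex.I) - Complex.exp ((φ₂ : ℂ) * Complex.I)) *
      (starRingEnd ℂ) ((c : ℂ) - Complex.exp ((φ₂ : ℂ) * Complex.I))).im) :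
    (∫ t in φ₁..ψ₁, 1 / Real.sqrt (I - Real.cos t)) =
      ∫ t in φ₂..ψ₂, 1 / Real.sqrt (I - Real.cos t) := by
  have h1 := cos_half_sub_of_isTangentLine h1l h1r htan1 hside1
  have h2 := cos_half_sub_of_isTangentLine h2l h2r htan2 hside2
  obtain ⟨e1, e1'⟩ := eq_chordHalfAngle h1l h1r h1
  obtain ⟨e2, e2'⟩ := eq_chordHalfAngle h2l h2r h2
  have key := integral_chord_const hc hr hcr hI ((φ₁ + ψ₁) / 2) ((φ₂ + ψ₂) / 2)
  rwa [← e1, ← e1', ← e2, ← e2'] at key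
end

section
/- Let c be a real number, r > 0, and let z = e^{iφ}, w = e^{iψ} be two distinct points on the unit circle. Then the line through z and w is tangent to the circle {ζ ∈ ℂ : |ζ − c| = r} if and only if p(z, w) = 0, where p(z,w) = (c·w·z − w − z + c)² − 4r²·w·z. -/
open ComplexConjugate in
/-- The distance from a real point `c` to the line through two points of the unit circle. -/
theorem iInf_dist_line_unit_circle (c : ℝ) {z w : ℂ} (hz : z * conj z = 1) (hw : w * conj w = 1)
    (hzw : z ≠ w) :
    (⨅ t : ℝ, dist (z + (t : ℂ) * (w - z)) c) = ‖(c : ℂ) * w * z - w - z + c‖ / 2 := by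
  have hz1 : ‖z‖ = 1 := by
    rw [Complex.mul_conj'] at hz
    have h : ‖z‖ ^ 2 = 1 := by exact_mod_cast hz
    exact (pow_eq_one_iff_of_nonneg (norm_nonneg _) two_ne_zero).1 h
  have hw1 : ‖w‖ = 1 := by
    rw [Complex.mul_conj'] at hw
    have h : ‖w‖ ^ 2 = 1 := by exact_mod_cast hw
    exact (pow_eq_one_iff_of_nonneg (norm_nonneg _) two_ne_zero).1 h
  have hne : w - z ≠ 0 := sub_ne_zero.2 hzw.symm
  have hne' : conj w - conj z ≠ 0 := by
    rw [← map_sub]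
    exact (map_ne_zero _).2 hne
  obtain ⟨s, hs⟩ : ∃ s : ℝ, (1 - w * z) / (w - z) = s := by
    refine Complex.conj_eq_iff_real.1 ?_
    simp only [map_div₀, map_sub, map_one, map_mul]
    rw [div_eq_div_iff hne' hne]
    linear_combination (conj w - w) * hz + (z - conj z) * hw
  rw [div_eq_iff hne] at hs
  have hleast : IsLeast (Set.range fun t : ℝ => dist (z + (t : ℂ) * (w - z)) c)
      (‖(c : ℂ) * w * z - w - z + c‖ / 2) := by
    constructor
    · refine ⟨(1 + c * s) / 2, ?_⟩
      have h : z + (((1 + c * s) / 2 : ℝ) : ℂ) * (w - z) - c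
          = -((c : ℂ) * w * z - w - z + c) / 2 := by
        push_cast
        linear_combination (-(c : ℂ) / 2) * hs
      simp only [dist_eq_norm]
      rw [h, norm_div, norm_neg, Complex.norm_ofNat]
    · rintro _ ⟨t, rfl⟩
      simp only [dist_eq_norm]
      set d := z + (t : ℂ) * (w - z) - c with hd
      have h : (c : ℂ) * w * z - w - z + c = -(d + z * w * conj d) := by
        simp only [hd, map_sub, map_add, map_mul, Complex.conj_ofReal]
        linear_combination ((1 - t) * w) * hz + (t * z) * hw
      have h2 : ‖d + z * w * conj d‖ ≤ ‖d‖ + ‖d‖ := by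
        refine (norm_add_le _ _).trans_eq ?_
        rw [norm_mul, norm_mul, hz1, hw1, RCLike.norm_conj, one_mul, one_mul]
      rw [h, norm_neg]
      linarith
  exact hleast.csInf_eq

open ComplexConjugate in
theorem sq_eq_norm_sq_mul_of_unit_circle (c : ℝ) {z w : ℂ} (hz : z * conj z = 1)
    (hw : w * conj w = 1) :
    ((c : ℂ) * w * z - w - z + c) ^ 2 = (‖(c : ℂ) * w * z - w - z + c‖ : ℂ) ^ 2 * (w * z) := by
  rw [← Complex.mul_conj']
  have h : (c : ℂ) * w * z - w - z + c = conj ((c : ℂ) * w * z - w - z + c) * (w * z) := by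
    simp only [map_sub, map_add, map_mul, Complex.conj_ofReal]
    linear_combination (w - c * w * conj w) * hz + (z - c) * hw
  linear_combination ((c : ℂ) * w * z - w - z + c) * h

theorem stmt7 (c r : ℝ) (hr : 0 < r) (φ ψ : ℝ) (z w : ℂ)
    (hz : z = Complex.exp ((φ : ℂ) * Complex.I))
    (hw : w = Complex.exp ((ψ : ℂ) * Complex.I))
    (hzw : z ≠ w) :
    IsTangentLine (c : ℂ) r z w ↔
      ((c : ℂ) * w * z - w - z + c) ^ 2 - 4 * (r : ℂ) ^ 2 * w * z = 0 := by
  have hz1 : z * (starRingEnd ℂ) z = 1 := by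
    rw [Complex.mul_conj', hz, Complex.norm_exp_ofReal_mul_I]; simp
  have hw1 : w * (starRingEnd ℂ) w = 1 := by
    rw [Complex.mul_conj', hw, Complex.norm_exp_ofReal_mul_I]; simp
  have hwz : w * z ≠ 0 := mul_ne_zero (left_ne_zero_of_mul_eq_one hw1)
    (left_ne_zero_of_mul_eq_one hz1)
  rw [IsTangentLine, iInf_dist_line_unit_circle c hz1 hw1 hzw,
    sq_eq_norm_sq_mul_of_unit_circle c hz1 hw1]
  have hN := norm_nonneg ((c : ℂ) * w * z - w - z + c)
  generalize ‖(c : ℂ) * w * z - w - z + c‖ = N at hN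
  have h : (N : ℂ) ^ 2 * (w * z) - 4 * (r : ℂ) ^ 2 * w * z
      = ((N ^ 2 - (2 * r) ^ 2 : ℝ) : ℂ) * (w * z) := by
    push_cast
    ring
  rw [h, mul_eq_zero, or_iff_left hwz, Complex.ofReal_eq_zero, sub_eq_zero,
    sq_eq_sq₀ hN (by positivity), div_eq_iff two_ne_zero, mul_comm r]
end

section
/- Let c, r be real numbers with c ≠ 0 and set I = (1 + c² − r²)/(2c). Then for all complex numbers z and w, writing y = w(1 − cz)² − z·r² − c(1 − 2Iz + z²), one has the identity (1 − cz)²·p(z, w) = y² − 4cr²(z³ − 2Iz² + z), where p(z,w) = (c·w·z − w − z + c)² − 4r²·w·z. In particular, if cz ≠ 1, then p(z, w) = 0 if and only if y² = 4cr²(z³ − 2Iz² + z). -/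
theorem stmt9 (c r : ℝ) (hc : c ≠ 0)
    (I : ℝ) (hI : I = (1 + c ^ 2 - r ^ 2) / (2 * c))
    (z w y : ℂ)
    (hy : y = w * (1 - (c : ℂ) * z) ^ 2 - z * (r : ℂ) ^ 2 -
      (c : ℂ) * (1 - 2 * (I : ℂ) * z + z ^ 2)) :
    (1 - (c : ℂ) * z) ^ 2 * (((c : ℂ) * w * z - w - z + c) ^ 2 - 4 * (r : ℂ) ^ 2 * w * z) =
      y ^ 2 - 4 * (c : ℂ) * (r : ℂ) ^ 2 * (z ^ 3 - 2 * (I : ℂ) * z ^ 2 + z) ∧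
    ((c : ℂ) * z ≠ 1 →
      (((c : ℂ) * w * z - w - z + c) ^ 2 - 4 * (r : ℂ) ^ 2 * w * z = 0 ↔
        y ^ 2 = 4 * (c : ℂ) * (r : ℂ) ^ 2 * (z ^ 3 - 2 * (I : ℂ) * z ^ 2 + z))) := by
  have hK : 2 * (c : ℂ) * (I : ℂ) = 1 + (c : ℂ) ^ 2 - (r : ℂ) ^ 2 := by
    have h : 2 * c * I = 1 + c ^ 2 - r ^ 2 := by rw [hI]; field_simp
    exact_mod_cast h
  have key : (1 - (c : ℂ) * z) ^ 2 *
      (((c : ℂ) * w * z - w - z + c) ^ 2 - 4 * (r : ℂ) ^ 2 * w * z) =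
      y ^ 2 - 4 * (c : ℂ) * (r : ℂ) ^ 2 * (z ^ 3 - 2 * (I : ℂ) * z ^ 2 + z) := by
    rw [hy]
    linear_combination
      (-(z * (2 * (w * (1 - (c : ℂ) * z) ^ 2 - z * (r : ℂ) ^ 2 - c - c * z ^ 2) +
        (2 * (c : ℂ) * I + (1 + (c : ℂ) ^ 2 - (r : ℂ) ^ 2)) * z) +
        4 * (r : ℂ) ^ 2 * z ^ 2)) * hK
  refine ⟨key, fun hz => ?_⟩
  have hA : (1 - (c : ℂ) * z) ^ 2 ≠ 0 := pow_ne_zero 2 (sub_ne_zero.mpr hz.symm)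
  rw [← sub_eq_zero (a := y ^ 2), ← key, mul_eq_zero, or_iff_right hA]
end

section
/- Assume w_k ≠ 0 for every k ≥ 1. Then for every k ≥ 1, 0 < w_k < I − √(I² − 1). -/
/-- The symmetric biquadratic form vanishing on consecutive terms of the sequence. -/
def biquad (c r x y : ℝ) : ℝ :=
  (1 - c * x) ^ 2 * y ^ 2 + (-2 * c + (2 + 2 * c ^ 2 - 4 * r ^ 2) * x - 2 * c * x ^ 2) * y +
    (c - x) ^ 2

lemma biquad_comm (c r x y : ℝ) : biquad c r x y = biquad c r y x := by
  unfold biquad; ring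

lemma biquad_one_pos {c r x : ℝ} (hr : 0 < r) (hcr : c + r < 1) (hx : 0 < x) :
    0 < biquad c r x 1 := by
  have h : biquad c r x 1 = (1 - c) ^ 2 * (1 - x) ^ 2 + 4 * (1 - c - r) * (1 - c + r) * x := by
    unfold biquad; ring
  rw [h]
  have h1 : 0 < 1 - c - r := by linarith
  have h2 : 0 < 1 - c + r := by linarith
  positivity

/-- The two roots of `biquad c r x` are exchanged by the recurrence (Vieta). -/
lemma biquad_eq_of_mul_eq {c r x y z : ℝ} (hy : y ≠ 0) (h : biquad c r x y = 0)
    (hz : (1 - c * x) ^ 2 * (y * z) = (c - x) ^ 2) (t : ℝ) :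
    biquad c r x t = (1 - c * x) ^ 2 * ((t - y) * (t - z)) := by
  unfold biquad at *
  apply mul_left_cancel₀ hy
  linear_combination t * h + (t - y) * hz

lemma biquad_sq_of_eq_zero {c r x y : ℝ} (h : biquad c r x y = 0) :
    (2 * (1 - c * x) ^ 2 * y + (-2 * c + (2 + 2 * c ^ 2 - 4 * r ^ 2) * x - 2 * c * x ^ 2)) ^ 2 =
      16 * r ^ 2 * x * (c * (1 + x ^ 2) - (1 + c ^ 2 - r ^ 2) * x) := by
  unfold biquad at h
  linear_combination 4 * (1 - c * x) ^ 2 * h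

section Recurrence

variable {c : ℝ} {w : ℕ → ℝ}

/-- A palindromic sequence of nonzero terms cannot satisfy the recurrence, since it would
return to `w 1 = c` and then vanish. -/
lemma not_reflected (hw1 : w 1 = c)
    (hwrec : ∀ k : ℕ, 2 ≤ k →
      w (k + 1) = (c - w k) ^ 2 / (w (k - 1) * (1 - c * w k) ^ 2))
    (hwnz : ∀ k : ℕ, 1 ≤ k → w k ≠ 0) (a : ℕ) :
    ∀ b : ℕ, 1 ≤ b → w (a + 2) = w b → w (a + 1) = w (b + 1) → False := by
  induction a with
  | zero =>
    intro b hb _ h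
    apply hwnz (b + 2) (by omega)
    rw [hwrec (b + 1) (by omega), ← h]
    simp [hw1]
  | succ a ih =>
    intro b hb h1 h2
    refine ih (b + 1) (by omega) h2 ?_
    have e1 := hwrec (a + 2) (by omega)
    have e2 := hwrec (b + 1) (by omega)
    simp only [Nat.add_sub_cancel, show a + 2 - 1 = a + 1 by omega] at e1 e2
    have n1 := hwnz (a + 1) (by omega)
    have n3 := hwnz (a + 2 + 1) (by omega)
    have h1' : w (a + 2 + 1) = w b := h1
    have h2' : w (a + 2) = w (b + 1) := h2
    show w (a + 1) = w (b + 1 + 1)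
    rw [e2, ← h1', ← h2', e1]
    have hd : w (a + 1) * (1 - c * w (a + 2)) ^ 2 ≠ 0 := by
      intro h; rw [h, div_zero] at e1; exact n3 e1
    have hn : (c - w (a + 2)) ^ 2 ≠ 0 := by
      intro h; rw [h, zero_div] at e1; exact n3 e1
    have hd' := (pow_ne_zero_iff two_ne_zero).1 (right_ne_zero_of_mul hd)
    have hn' := (pow_ne_zero_iff two_ne_zero).1 hn
    field_simp

end Recurrence

theorem stmt11 (c r : ℝ) (hc : 0 < c) (hr : 0 < r) (hcr : c + r < 1)
    (I : ℝ) (hI : I = (1 + c ^ 2 - r ^ 2) / (2 * c))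
    (w : ℕ → ℝ) (hw0 : w 0 = 0) (hw1 : w 1 = c)
    (hw2 : w 2 = 4 * c * r ^ 2 / (1 - c ^ 2) ^ 2)
    (hwrec : ∀ k : ℕ, 2 ≤ k →
      w (k + 1) = (c - w k) ^ 2 / (w (k - 1) * (1 - c * w k) ^ 2))
    (hwnz : ∀ k : ℕ, 1 ≤ k → w k ≠ 0) :
    ∀ k : ℕ, 1 ≤ k → 0 < w k ∧ w k < I - Real.sqrt (I ^ 2 - 1) := by
  have hc1 : 0 < 1 - c := by linarith
  have hA : ∀ x : ℝ, x < 1 → 0 < 1 - c * x := fun x hx => by nlinarith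
  have key : ∀ k : ℕ, 0 < w (k + 1) ∧ w (k + 1) < 1 ∧ 0 < w (k + 2) ∧ w (k + 2) < 1 ∧
      biquad c r (w (k + 1)) (w (k + 2)) = 0 := by
    intro k
    induction k with
    | zero =>
      have hpos : 0 < 1 - c ^ 2 := by nlinarith
      refine ⟨by simpa [hw1], by simp only [zero_add, hw1]; linarith, ?_, ?_, ?_⟩
      · simp only [zero_add, hw2]; positivity
      · simp only [zero_add, hw2]
        rw [div_lt_one (by positivity)]
        have h1 : r ^ 2 < (1 - c) ^ 2 := by nlinarith
        nlinarith [sq_nonneg ((1 - c) * (1 - c))]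
      · simp only [zero_add, hw1, hw2, biquad]
        field_simp
        ring
    | succ k ih =>
      obtain ⟨hy0, hy1, hx0, hx1, hF⟩ := ih
      have hAx := hA _ hx1
      have hrec := hwrec (k + 2) (by omega)
      simp only [show k + 2 - 1 = k + 1 by omega] at hrec
      have hz0 : 0 < w (k + 2 + 1) := by
        refine lt_of_le_of_ne ?_ (hwnz _ (by omega)).symm
        rw [hrec]; positivity
      have hz : (1 - c * w (k + 2)) ^ 2 * (w (k + 1) * w (k + 2 + 1)) = (c - w (k + 2)) ^ 2 := by
        rw [hrec]; field_simp
      rw [biquad_comm] at hF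
      have hfac := biquad_eq_of_mul_eq hy0.ne' hF hz
      refine ⟨hx0, hx1, hz0, ?_, ?_⟩
      · have h1 := biquad_one_pos hr hcr hx0
        rw [hfac 1] at h1
        have h2 := pos_of_mul_pos_right h1 (by positivity)
        have h3 := pos_of_mul_pos_right h2 (by linarith)
        show w (k + 2 + 1) < 1
        linarith
      · show biquad c r (w (k + 2)) (w (k + 2 + 1)) = 0
        rw [hfac]; ring
  intro k hk
  obtain ⟨n, rfl⟩ : ∃ n, k = n + 1 := ⟨k - 1, by omega⟩
  obtain ⟨hx0, hx1, hy0, -, hF⟩ := key n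
  refine ⟨hx0, ?_⟩
  have hsq := biquad_sq_of_eq_zero hF
  have hq : 0 < c * (1 + w (n + 1) ^ 2) - (1 + c ^ 2 - r ^ 2) * w (n + 1) := by
    have hge : 0 ≤ c * (1 + w (n + 1) ^ 2) - (1 + c ^ 2 - r ^ 2) * w (n + 1) := by
      refine nonneg_of_mul_nonneg_right (a := 16 * r ^ 2 * w (n + 1)) ?_ (by positivity)
      rw [← hsq]; positivity
    refine lt_of_le_of_ne hge fun h0 => ?_
    rcases n with _ | a
    · simp only [zero_add, hw1] at h0
      have : 0 < r ^ 2 * c := by positivity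
      nlinarith
    · have hF' := (key a).2.2.2.2
      rw [biquad_comm] at hF'
      have hsq' := biquad_sq_of_eq_zero hF'
      rw [← h0, mul_zero] at hsq
      have h0' : c * (1 + w (a + 2) ^ 2) - (1 + c ^ 2 - r ^ 2) * w (a + 2) = 0 := h0.symm
      rw [h0', mul_zero] at hsq'
      have e1 := pow_eq_zero_iff (two_ne_zero) |>.1 hsq
      have e2 := pow_eq_zero_iff (two_ne_zero) |>.1 hsq'
      have hAx : 0 < 1 - c * w (a + 2) := hA _ hx1
      refine not_reflected hw1 hwrec hwnz a (a + 2) (by omega) rfl ?_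
      have hne : 2 * (1 - c * w (a + 2)) ^ 2 ≠ 0 := by positivity
      apply mul_left_cancel₀ hne
      have e1' : 2 * (1 - c * w (a + 2)) ^ 2 * w (a + 2 + 1) + (-2 * c +
        (2 + 2 * c ^ 2 - 4 * r ^ 2) * w (a + 2) - 2 * c * w (a + 2) ^ 2) = 0 := e1
      linarith
  have hIc : 2 * c * I = 1 + c ^ 2 - r ^ 2 := by rw [hI]; field_simp
  have hI1 : 1 < I := by
    rw [hI, lt_div_iff₀ (by positivity)]
    nlinarith
  rw [← hIc] at hq
  have hq' : 0 < 1 + w (n + 1) ^ 2 - 2 * I * w (n + 1) := by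
    refine pos_of_mul_pos_right (a := c) ?_ hc.le
    linarith
  have : Real.sqrt (I ^ 2 - 1) < I - w (n + 1) := by
    rw [Real.sqrt_lt' (by linarith)]
    linarith
  linarith
end

section
/- Let 0 < ψ < π/2 and 0 < k < 1, and define c = (√(1 − k²cos²ψ) − √(1 − k²))²/(k² sin²ψ) and r = (1 − c)·cos ψ. Then 0 < c, 0 < r, c + r < 1, (1 + c² − r²)/(2c) = 2/k² − 1, and 2r²/(1 − c)² − 1 = cos 2ψ. -/
theorem stmt14 (ψ k : ℝ) (hψ0 : 0 < ψ) (hψ : ψ < Real.pi / 2)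
    (hk0 : 0 < k) (hk1 : k < 1) (c r : ℝ)
    (hc : c = (Real.sqrt (1 - k ^ 2 * Real.cos ψ ^ 2) - Real.sqrt (1 - k ^ 2)) ^ 2 /
      (k ^ 2 * Real.sin ψ ^ 2))
    (hr : r = (1 - c) * Real.cos ψ) :
    0 < c ∧ 0 < r ∧ c + r < 1 ∧
      (1 + c ^ 2 - r ^ 2) / (2 * c) = 2 / k ^ 2 - 1 ∧
      2 * r ^ 2 / (1 - c) ^ 2 - 1 = Real.cos (2 * ψ) := by
  have hS : 0 < Real.sin ψ := Real.sin_pos_of_pos_of_lt_pi hψ0 (by linarith [Real.pi_pos])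
  have hC : 0 < Real.cos ψ := Real.cos_pos_of_mem_Ioo ⟨by linarith, hψ⟩
  have hSC := Real.sin_sq_add_cos_sq ψ
  have hcos := Real.cos_two_mul ψ
  generalize Real.sin ψ = S at *
  generalize Real.cos ψ = C at *
  have hC1 : C < 1 := by nlinarith
  have hk2 : 0 < 1 - k ^ 2 := by nlinarith
  have hkS : 0 < k ^ 2 * S ^ 2 := by positivity
  have hlt : 1 - k ^ 2 < 1 - k ^ 2 * C ^ 2 := by
    linear_combination hkS + k ^ 2 * hSC
  have hb : 0 < √(1 - k ^ 2) := Real.sqrt_pos.2 hk2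
  have hab : √(1 - k ^ 2) < √(1 - k ^ 2 * C ^ 2) := Real.sqrt_lt_sqrt hk2.le hlt
  have ha2 := Real.sq_sqrt (hk2.trans hlt).le
  have hb2 := Real.sq_sqrt hk2.le
  generalize √(1 - k ^ 2) = b at *
  generalize √(1 - k ^ 2 * C ^ 2) = a at *
  have hsum : 0 < a + b := by linarith
  have hdiff : 0 < a - b := by linarith
  have hprod : k ^ 2 * S ^ 2 = (a - b) * (a + b) := by
    linear_combination k ^ 2 * hSC - ha2 + hb2
  have hc' : c = (a - b) / (a + b) := by
    rw [hc, hprod]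
    field_simp
  have h1c : 1 - c = 2 * b / (a + b) := by
    rw [hc']
    field_simp
    ring
  have hc0 : 0 < c := by
    rw [hc']
    positivity
  have h1c0 : 0 < 1 - c := by
    rw [h1c]
    positivity
  refine ⟨hc0, hr ▸ mul_pos h1c0 hC, by nlinarith, ?_, ?_⟩
  · have hnum : 1 + c ^ 2 - r ^ 2 = 2 * (a ^ 2 + b ^ 2 - 2 * b ^ 2 * C ^ 2) / (a + b) ^ 2 := by
      rw [hr, h1c, hc']
      field_simp
      ring
    have hden : 2 * c = 2 * (k ^ 2 * S ^ 2) / (a + b) ^ 2 := by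
      rw [hprod, hc']
      field_simp
    have hred : a ^ 2 + b ^ 2 - 2 * b ^ 2 * C ^ 2 = (2 - k ^ 2) * S ^ 2 := by
      linear_combination ha2 + (1 - 2 * C ^ 2) * hb2 - (2 - k ^ 2) * hSC
    rw [hnum, hden, hred]
    field_simp
  · rw [hcos, hr]
    field_simp
end
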